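/- Let (A, H, ▷, ◁) be a matched pair of groups and r : H → A a deformation map. Then the subset {(r(h), h) | h ∈ H} is a subgroup of the bicrossed product A ⋈ H isomorphic to the r-deformation H_r, and A ⋈ H factorizes through A × {1} and this subgroup; in particular H_r is an A-complement of A ⋈ H. -/

import Mathlib

/-- A matched pair of groups `(A, H, ▷, ◁)`. -/
structure MatchedPair (A H : Type*) [Group A] [Group H] where
  tr : H → A → A
  tl : H → A → H
  tr_one_act : ∀ a, tr 1 a = a
  tr_mul_act : ∀ h g a, tr (h * g) a = tr h (tr g a)
  tl_one_act : ∀ h, tl h 1 = h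
  tl_mul_act : ∀ h a b, tl h (a * b) = tl (tl h a) b
  compat_tr : ∀ h a b, tr h (a * b) = tr h a * tr (tl h a) b
  compat_tl : ∀ h g a, tl (h * g) a = tl h (tr g a) * tl g a

/-- The multiplication of the bicrossed product `A ⋈ H`. -/
def MatchedPair.bmul {A H : Type*} [Group A] [Group H] (mp : MatchedPair A H)
    (p q : A × H) : A × H :=
  (p.1 * mp.tr p.2 q.1, mp.tl p.2 q.1 * q.2)

/-- A deformation map of the matched pair. -/
def MatchedPair.IsDeformationMap {A H : Type*} [Group A] [Group H]
    (mp : MatchedPair A H) (r : H → A) : Prop :=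
  r 1 = 1 ∧ ∀ h g, r (mp.tl h (r g) * g) = r h * mp.tr h (r g)

/-- The deformed multiplication `h • g = (h ◁ r(g)) g` of the group `H_r`. -/
def MatchedPair.dmul {A H : Type*} [Group A] [Group H]
    (mp : MatchedPair A H) (r : H → A) (h g : H) : H :=
  mp.tl h (r g) * g

namespace MatchedPair

variable {A H : Type*} [Group A] [Group H] (mp : MatchedPair A H)

lemma tl_one_left (a : A) : mp.tl 1 a = 1 := by
  have h := mp.compat_tl 1 1 a
  rw [mp.tr_one_act, mul_one] at h
  exact left_eq_mul.mp h

lemma dmul_assoc {r : H → A} (hr : mp.IsDeformationMap r) (h g k : H) :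
    mp.dmul r (mp.dmul r h g) k = mp.dmul r h (mp.dmul r g k) := by
  simp only [dmul, hr.2, mp.tl_mul_act, mp.compat_tl, mul_assoc]

lemma one_dmul (r : H → A) (h : H) : mp.dmul r 1 h = h := by
  simp [dmul, mp.tl_one_left]

lemma dmul_one {r : H → A} (hr : mp.IsDeformationMap r) (h : H) : mp.dmul r h 1 = h := by
  simp [dmul, hr.1, mp.tl_one_act]

lemma exists_dmul_eq_one_left (r : H → A) (h : H) : ∃ k, mp.dmul r k h = 1 :=
  ⟨mp.tl h⁻¹ (r h)⁻¹, by simp [dmul, ← mp.tl_mul_act, mp.tl_one_act]⟩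

lemma exists_dmul_eq_one {r : H → A} (hr : mp.IsDeformationMap r) (h : H) :
    ∃ k, mp.dmul r h k = 1 ∧ mp.dmul r k h = 1 := by
  obtain ⟨k, hk⟩ := mp.exists_dmul_eq_one_left r h
  obtain ⟨l, hl⟩ := mp.exists_dmul_eq_one_left r k
  have hlh : l = h := by
    rw [← mp.dmul_one hr l, ← hk, ← mp.dmul_assoc hr, hl, mp.one_dmul]
  exact ⟨k, hlh ▸ hl, hk⟩

lemma bmul_graph {r : H → A} (hr : mp.IsDeformationMap r) (h g : H) :
    mp.bmul (r h, h) (r g, g) = (r (mp.dmul r h g), mp.dmul r h g) :=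
  Prod.ext (hr.2 h g).symm rfl

lemma bmul_one_right (a b : A) (h : H) : mp.bmul (a, 1) (b, h) = (a * b, h) := by
  simp [bmul, mp.tr_one_act, mp.tl_one_left]

end MatchedPair

/-- Given a matched pair `(A, H, ▷, ◁)` and a deformation map `r : H → A`, the subset
`S = {(r(h), h) | h ∈ H}` is a subgroup of the bicrossed product `A ⋈ H`, the map
`h ↦ (r(h), h)` is an isomorphism from the `r`-deformation `H_r` onto `S`, and `A ⋈ H`
factorizes through `A × {1}` and `S`; in particular `H_r` is an `A`-complement of
`A ⋈ H`. -/
theorem stmt8 {A H : Type*} [Group A] [Group H] (mp : MatchedPair A H)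
    (r : H → A) (hr : mp.IsDeformationMap r) :
    -- `S` contains the unit and is closed under multiplication and inverses of `A ⋈ H`
    ((1 : A), (1 : H)) ∈ {p : A × H | ∃ h : H, p = (r h, h)} ∧
    (∀ p q : A × H, p ∈ {p : A × H | ∃ h : H, p = (r h, h)} →
      q ∈ {p : A × H | ∃ h : H, p = (r h, h)} →
      mp.bmul p q ∈ {p : A × H | ∃ h : H, p = (r h, h)}) ∧
    (∀ p ∈ {p : A × H | ∃ h : H, p = (r h, h)},
      ∃ q ∈ {p : A × H | ∃ h : H, p = (r h, h)},
        mp.bmul p q = (1, 1) ∧ mp.bmul q p = (1, 1)) ∧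
    -- `h ↦ (r(h), h)` is an isomorphism of groups `H_r ≅ S`
    Function.Injective (fun h : H => ((r h, h) : A × H)) ∧
    (Set.range (fun h : H => ((r h, h) : A × H)) = {p : A × H | ∃ h : H, p = (r h, h)}) ∧
    (∀ h g : H, ((r (mp.dmul r h g), mp.dmul r h g) : A × H) =
      mp.bmul (r h, h) (r g, g)) ∧
    -- `A ⋈ H` factorizes through `A × {1}` and `S`
    (∀ p : A × H, ∃ (a : A) (h : H), p = mp.bmul (a, 1) (r h, h)) ∧
    (∀ (a : A) (h : H), ((a, (1 : H)) : A × H) = (r h, h) → a = 1 ∧ h = 1) := by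
  refine ⟨⟨1, by rw [hr.1]⟩, ?_, ?_, fun h g e => congrArg Prod.snd e, ?_,
    fun h g => (mp.bmul_graph hr h g).symm, ?_, ?_⟩
  · rintro _ _ ⟨h, rfl⟩ ⟨g, rfl⟩
    exact ⟨_, mp.bmul_graph hr h g⟩
  · rintro _ ⟨h, rfl⟩
    obtain ⟨k, hk, kh⟩ := mp.exists_dmul_eq_one hr h
    exact ⟨_, ⟨k, rfl⟩, by rw [mp.bmul_graph hr, hk, hr.1], by rw [mp.bmul_graph hr, kh, hr.1]⟩
  · ext p
    simp [eq_comm]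
  · rintro ⟨a, h⟩
    exact ⟨a * (r h)⁻¹, h, by simp [mp.bmul_one_right]⟩
  · rintro a h e
    obtain ⟨rfl, rfl⟩ := Prod.mk.inj e
    exact ⟨hr.1, rfl⟩
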